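/- arXiv:2208.03981 — 3 statements merged into one kernel-verified Lean document; each statement's English description precedes it below -/
import Mathlib

section
/- Let A₀ be a densely defined skew-symmetric operator on a Hilbert space V over 𝕂 = ℝ or ℂ, let Ā₀ be its closure and A = (−A₀)*. For w ∈ D(A) let w = w₀ + w₊ + w₋ be the unique decomposition with w₀ ∈ D(Ā₀), Aw₊ = w₊, Aw₋ = −w₋, and define Γ₊w := w₊ and Γ₋w := w₋. Then, with H₋ := ker(Id + A) and H₊ := ker(Id − A) equipped with inner products ⟨·,·⟩ := 2⟨·,·⟩_V, (H₋, H₊, Γ₋, Γ₊) is a boundary quadruple for A₀, i.e. Γ₋, Γ₊ are surjective linear maps satisfying ⟨Au, v⟩_V + ⟨u, Av⟩_V = ⟨Γ₊u, Γ₊v⟩_{H₊} − ⟨Γ₋u, Γ₋v⟩_{H₋} for all u, v ∈ D(A) and ker Γ₋ + ker Γ₊ = D(A). -/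
variable {𝕜 V : Type*} [RCLike 𝕜] [NormedAddCommGroup V] [InnerProductSpace 𝕜 V]
  [CompleteSpace V]

/-- An operator `A` on `V` is *skew-symmetric* if `⟪Au, v⟫ + ⟪u, Av⟫ = 0` for all
`u, v ∈ D(A)`. -/
def SkewSymmetric (A : V →ₗ.[𝕜] V) : Prop :=
  ∀ u v : A.domain, @inner 𝕜 _ _ (A u) (v : V) + @inner 𝕜 _ _ (u : V) (A v) = 0

/-- The kernel `ker(Id - T) = {x ∈ D(T) : Tx = x}`, as a submodule of `V`. -/
def kerIdSub (T : V →ₗ.[𝕜] V) : Submodule 𝕜 V :=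
  (LinearMap.ker (T.domain.subtype - T.toFun)).map T.domain.subtype

/-- The kernel `ker(Id + T) = {x ∈ D(T) : Tx = -x}`, as a submodule of `V`. -/
def kerIdAdd (T : V →ₗ.[𝕜] V) : Submodule 𝕜 V :=
  (LinearMap.ker (T.domain.subtype + T.toFun)).map T.domain.subtype

theorem mem_kerIdSub_iff {W : Type*} [NormedAddCommGroup W] [InnerProductSpace 𝕜 W]
    {T : W →ₗ.[𝕜] W} {x : W} : x ∈ kerIdSub T ↔ (x, x) ∈ T.graph := by
  simp only [kerIdSub, Submodule.mem_map, LinearMap.mem_ker, LinearMap.sub_apply, sub_eq_zero,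
    LinearPMap.mem_graph_iff, Submodule.subtype_apply, LinearPMap.toFun_eq_coe]
  exact exists_congr fun y => ⟨fun ⟨h, hy⟩ => ⟨hy, h ▸ hy⟩, fun ⟨hy, h⟩ => ⟨hy.trans h.symm, hy⟩⟩

theorem mem_kerIdAdd_iff {W : Type*} [NormedAddCommGroup W] [InnerProductSpace 𝕜 W]
    {T : W →ₗ.[𝕜] W} {x : W} : x ∈ kerIdAdd T ↔ (x, -x) ∈ T.graph := by
  simp only [kerIdAdd, Submodule.mem_map, LinearMap.mem_ker, LinearMap.add_apply,
    LinearPMap.mem_graph_iff, Submodule.subtype_apply, LinearPMap.toFun_eq_coe]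
  refine exists_congr fun y => ⟨fun ⟨h, hy⟩ => ⟨hy, ?_⟩, fun ⟨hy, h⟩ => ⟨?_, hy⟩⟩
  · rw [← hy]
    exact eq_neg_of_add_eq_zero_right h
  · rw [hy, h, add_neg_cancel]

namespace SkewSymmetric

variable {A₀ : V →ₗ.[𝕜] V}

theorem le_adjoint_neg (hskew : SkewSymmetric A₀) (hdense : Dense (A₀.domain : Set V)) :
    A₀ ≤ (-A₀).adjoint := by
  refine LinearPMap.IsFormalAdjoint.le_adjoint (T := -A₀) hdense fun x y => ?_
  rw [LinearPMap.neg_apply, inner_neg_left]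
  exact (eq_neg_of_add_eq_zero_right (hskew x y)).symm

theorem isClosable (hskew : SkewSymmetric A₀) (hdense : Dense (A₀.domain : Set V)) :
    A₀.IsClosable :=
  (LinearPMap.adjoint_isClosed (T := -A₀) hdense).isClosable.leIsClosable
    (hskew.le_adjoint_neg hdense)

theorem closure_graph_le (hskew : SkewSymmetric A₀) (hdense : Dense (A₀.domain : Set V)) :
    A₀.closure.graph ≤ (-A₀).adjoint.graph := by
  rw [← (hskew.isClosable hdense).graph_closure_eq_closure_graph]
  exact Submodule.topologicalClosure_minimal _
    (LinearPMap.le_graph_of_le (hskew.le_adjoint_neg hdense))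
    (LinearPMap.adjoint_isClosed (T := -A₀) hdense)

/-- The boundary form of `(-A₀)*` vanishes as soon as one argument lies in the domain of the
closure of `A₀`. -/
theorem inner_add_inner_eq_zero (hskew : SkewSymmetric A₀)
    (hdense : Dense (A₀.domain : Set V)) {x x' y y' : V} (hx : (x, x') ∈ A₀.closure.graph)
    (hy : (y, y') ∈ (-A₀).adjoint.graph) :
    inner 𝕜 x' y + inner 𝕜 x y' = 0 := by
  rw [← (hskew.isClosable hdense).graph_closure_eq_closure_graph] at hx
  have hclosed : IsClosed {p : V × V | inner 𝕜 p.2 y + inner 𝕜 p.1 y' = 0} :=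
    isClosed_eq (by fun_prop) continuous_const
  refine closure_minimal (fun p hp => ?_) hclosed hx
  obtain ⟨a, ha, ha'⟩ := (LinearPMap.mem_graph_iff _).1 hp
  obtain ⟨b, hb, hb'⟩ := (LinearPMap.mem_graph_iff _).1 hy
  have h := (LinearPMap.adjoint_isFormalAdjoint (T := -A₀) hdense).symm a b
  rw [LinearPMap.neg_apply, inner_neg_left] at h
  simp only at hb hb'
  rw [Set.mem_ofPred_eq, ← ha, ← ha', ← hb, ← hb', ← h, add_neg_cancel]

theorem inner_add_inner_eq_zero' (hskew : SkewSymmetric A₀)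
    (hdense : Dense (A₀.domain : Set V)) {x x' y y' : V} (hx : (x, x') ∈ A₀.closure.graph)
    (hy : (y, y') ∈ (-A₀).adjoint.graph) :
    inner 𝕜 y x' + inner 𝕜 y' x = 0 := by
  rw [← inner_conj_symm y, ← inner_conj_symm y', ← map_add,
    hskew.inner_add_inner_eq_zero hdense hx hy, map_zero]

theorem mem_closure_graph (hskew : SkewSymmetric A₀) (hdense : Dense (A₀.domain : Set V))
    {x x' : V} (hx : x ∈ A₀.closure.domain) (hx' : (x, x') ∈ (-A₀).adjoint.graph) :
    (x, x') ∈ A₀.closure.graph := by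
  have h := A₀.closure.mem_graph ⟨x, hx⟩
  rwa [(-A₀).adjoint.mem_graph_snd_inj (hskew.closure_graph_le hdense h) hx' rfl] at h

/-- The sum `D(Ā₀) + ker(Id - A) + ker(Id + A)` is direct. -/
theorem eq_zero_of_add_mem_closure_domain (hskew : SkewSymmetric A₀)
    (hdense : Dense (A₀.domain : Set V)) {p m : V} (hp : p ∈ kerIdSub (-A₀).adjoint)
    (hm : m ∈ kerIdAdd (-A₀).adjoint) (h : p + m ∈ A₀.closure.domain) :
    p = 0 ∧ m = 0 := by
  rw [mem_kerIdSub_iff] at hp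
  rw [mem_kerIdAdd_iff] at hm
  have hg := hskew.mem_closure_graph hdense h (add_mem hp hm)
  have h₁ := hskew.inner_add_inner_eq_zero hdense hg hp
  have h₂ := hskew.inner_add_inner_eq_zero hdense hg hm
  simp only [inner_add_left, inner_neg_left, inner_neg_right] at h₁ h₂
  constructor
  · rw [← inner_self_eq_zero (𝕜 := 𝕜)]
    linear_combination h₁ / 2
  · rw [← inner_self_eq_zero (𝕜 := 𝕜)]
    linear_combination -h₂ / 2

end SkewSymmetric

/-- Let `A₀` be a densely defined skew-symmetric operator, `Ā₀` its closure, `A = (-A₀)*`.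
For `w ∈ D(A)` write `w = w₀ + w₊ + w₋` with `w₀ ∈ D(Ā₀)`, `w₊ ∈ ker(Id - A)`,
`w₋ ∈ ker(Id + A)`, and set `Γ₊ w := w₊`, `Γ₋ w := w₋`.  Then, with
`H₋ := ker(Id + A)` and `H₊ := ker(Id - A)` equipped with the inner products `2⟪·,·⟫_V`,
`(H₋, H₊, Γ₋, Γ₊)` is a boundary quadruple for `A₀`: `Γ₋, Γ₊` are surjective,
`⟪Au, v⟫_V + ⟪u, Av⟫_V = 2⟪Γ₊u, Γ₊v⟫_V - 2⟪Γ₋u, Γ₋v⟫_V` for all `u, v ∈ D(A)`, and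
`ker Γ₋ + ker Γ₊ = D(A)`. -/
theorem decomposition_boundaryQuadruple (A₀ : V →ₗ.[𝕜] V)
    (hdense : Dense (A₀.domain : Set V)) (hskew : SkewSymmetric A₀)
    (Γm : ((-A₀).adjoint).domain →ₗ[𝕜] (kerIdAdd (-A₀).adjoint))
    (Γp : ((-A₀).adjoint).domain →ₗ[𝕜] (kerIdSub (-A₀).adjoint))
    (hdecomp : ∀ w : ((-A₀).adjoint).domain,
      (w : V) - (Γp w : V) - (Γm w : V) ∈ A₀.closure.domain) :
    Function.Surjective Γm ∧ Function.Surjective Γp ∧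
      (∀ u v : ((-A₀).adjoint).domain,
        @inner 𝕜 _ _ ((-A₀).adjoint u) (v : V) + @inner 𝕜 _ _ (u : V) ((-A₀).adjoint v) =
          2 * @inner 𝕜 _ _ ((Γp u : V)) ((Γp v : V)) -
            2 * @inner 𝕜 _ _ ((Γm u : V)) ((Γm v : V))) ∧
      LinearMap.ker Γm ⊔ LinearMap.ker Γp = ⊤ := by
  have hp (w) := mem_kerIdSub_iff.1 (Γp w).2
  have hm (w) := mem_kerIdAdd_iff.1 (Γm w).2
  have hΓm {x : ((-A₀).adjoint).domain} (hx : (x : V) ∈ kerIdAdd (-A₀).adjoint) :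
      Γp x = 0 ∧ Γm x = ⟨x, hx⟩ := by
    have h := hskew.eq_zero_of_add_mem_closure_domain hdense (neg_mem (Γp x).2)
      (sub_mem hx (Γm x).2) (by convert hdecomp x using 1; abel)
    exact ⟨Subtype.ext (neg_eq_zero.1 h.1), Subtype.ext (sub_eq_zero.1 h.2).symm⟩
  have hΓp {x : ((-A₀).adjoint).domain} (hx : (x : V) ∈ kerIdSub (-A₀).adjoint) :
      Γm x = 0 ∧ Γp x = ⟨x, hx⟩ := by
    have h := hskew.eq_zero_of_add_mem_closure_domain hdense (sub_mem hx (Γp x).2)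
      (neg_mem (Γm x).2) (by convert hdecomp x using 1; abel)
    exact ⟨Subtype.ext (neg_eq_zero.1 h.2), Subtype.ext (sub_eq_zero.1 h.1).symm⟩
  refine ⟨fun y => ⟨⟨y, LinearPMap.mem_domain_of_mem_graph (mem_kerIdAdd_iff.1 y.2)⟩,
      (hΓm y.2).2⟩,
    fun y => ⟨⟨y, LinearPMap.mem_domain_of_mem_graph (mem_kerIdSub_iff.1 y.2)⟩,
      (hΓp y.2).2⟩, fun u v => ?_, ?_⟩
  · have hg (w : ((-A₀).adjoint).domain) := hskew.mem_closure_graph hdense (hdecomp w)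
      (sub_mem (sub_mem ((-A₀).adjoint.mem_graph w) (hp w)) (hm w))
    have h₁ := hskew.inner_add_inner_eq_zero hdense (hg u) ((-A₀).adjoint.mem_graph v)
    have h₂ := hskew.inner_add_inner_eq_zero' hdense (hg v) (hp u)
    have h₃ := hskew.inner_add_inner_eq_zero' hdense (hg v) (hm u)
    simp only [Prod.snd_sub, inner_sub_left, inner_sub_right, inner_neg_left,
      inner_neg_right] at h₁ h₂ h₃
    linear_combination h₁ + h₂ + h₃
  · refine eq_top_iff.2 fun w _ => ?_
    let x : ((-A₀).adjoint).domain := ⟨Γp w, LinearPMap.mem_domain_of_mem_graph (hp w)⟩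
    obtain ⟨hx₁, hx₂⟩ := hΓp (x := x) (Γp w).2
    rw [← add_sub_cancel x w]
    refine Submodule.add_mem_sup hx₁ ?_
    rw [LinearMap.mem_ker, map_sub, hx₂]
    exact sub_self _
end

section
/- Let (H₋, H₊, Γ₋, Γ₊) be a boundary quadruple for a densely defined skew-symmetric operator A₀ on a Hilbert space V, with A = (−A₀)*, and let B be an operator on V with A₀ ⊆ B. Then B is m-dissipative if and only if there exists a linear contraction Φ: H₋ → H₊ such that B = A_Φ, i.e. D(B) = {w ∈ D(A) : Φ Γ₋ w = Γ₊ w} and Bw = Aw for all w ∈ D(B). -/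
variable {𝕜 V : Type*} [RCLike 𝕜] [NormedAddCommGroup V] [InnerProductSpace 𝕜 V]
  [CompleteSpace V]

/-- A *boundary quadruple* `(H₋, H₊, Γ₋, Γ₊)` for a densely defined skew-symmetric operator
`A₀` (here expressed via `A := (-A₀)*`) consists of pre-Hilbert spaces `H₋, H₊` and surjective
linear maps `Γ₋ : D(A) → H₋`, `Γ₊ : D(A) → H₊` such that
`⟪Au, v⟫ + ⟪u, Av⟫ = ⟪Γ₊u, Γ₊v⟫ - ⟪Γ₋u, Γ₋v⟫` for all `u, v ∈ D(A)` and
`ker Γ₋ + ker Γ₊ = D(A)`. -/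
def IsBoundaryQuadruple (A : V →ₗ.[𝕜] V) {Hm Hp : Type*}
    [NormedAddCommGroup Hm] [InnerProductSpace 𝕜 Hm]
    [NormedAddCommGroup Hp] [InnerProductSpace 𝕜 Hp]
    (Γm : A.domain →ₗ[𝕜] Hm) (Γp : A.domain →ₗ[𝕜] Hp) : Prop :=
  Function.Surjective Γm ∧ Function.Surjective Γp ∧
    (∀ u v : A.domain,
      @inner 𝕜 _ _ (A u) (v : V) + @inner 𝕜 _ _ (u : V) (A v) =
        @inner 𝕜 _ _ (Γp u) (Γp v) - @inner 𝕜 _ _ (Γm u) (Γm v)) ∧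
    LinearMap.ker Γm ⊔ LinearMap.ker Γp = ⊤

/-- An operator `A` on `V` is *dissipative* if `Re ⟪Ax, x⟫ ≤ 0` for all `x ∈ D(A)`. -/
def Dissipative (A : V →ₗ.[𝕜] V) : Prop :=
  ∀ x : A.domain, RCLike.re (@inner 𝕜 _ _ (A x) (x : V)) ≤ 0

/-- `A` is *m-dissipative* if it is dissipative and `(Id - A) D(A) = V`. -/
def MDissipative (A : V →ₗ.[𝕜] V) : Prop :=
  Dissipative A ∧ ∀ y : V, ∃ x : A.domain, (x : V) - A x = y

/-- The data of a boundary quadruple seen through the inclusion `j : D(A) → V` and the action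
`a : D(A) → V` of `A`. Unlike `IsBoundaryQuadruple`, this notion is invariant under replacing
`(a, Γm, Γp)` by `(-a, Γp, Γm)`. -/
structure BoundarySystem {D Hm Hp : Type*} [AddCommGroup D] [Module 𝕜 D]
    [NormedAddCommGroup Hm] [InnerProductSpace 𝕜 Hm]
    [NormedAddCommGroup Hp] [InnerProductSpace 𝕜 Hp]
    (j a : D →ₗ[𝕜] V) (Γm : D →ₗ[𝕜] Hm) (Γp : D →ₗ[𝕜] Hp) : Prop where
  injective : Function.Injective j
  isClosed : IsClosed ((LinearMap.range (j.prod a) : Submodule 𝕜 (V × V)) : Set (V × V))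
  green : ∀ u v : D, inner 𝕜 (a u) (j v) + inner 𝕜 (j u) (a v) =
    inner 𝕜 (Γp u) (Γp v) - inner 𝕜 (Γm u) (Γm v)
  surjective : ∀ h k, ∃ w, Γm w = h ∧ Γp w = k
  exists_neg : ∀ y : V, (∀ u, Γm u = 0 → Γp u = 0 → inner 𝕜 y (j u - a u) = 0) →
    ∃ x, j x = y ∧ a x = -y
  exists_pos : ∀ y : V, (∀ u, Γm u = 0 → Γp u = 0 → inner 𝕜 y (j u + a u) = 0) →
    ∃ x, j x = y ∧ a x = y

namespace BoundarySystem

open Filter Topology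

variable {D Hm Hp : Type*} [AddCommGroup D] [Module 𝕜 D]
    [NormedAddCommGroup Hm] [InnerProductSpace 𝕜 Hm]
    [NormedAddCommGroup Hp] [InnerProductSpace 𝕜 Hp]
    {j a : D →ₗ[𝕜] V} {Γm : D →ₗ[𝕜] Hm} {Γp : D →ₗ[𝕜] Hp}

theorem symm (S : BoundarySystem j a Γm Γp) : BoundarySystem j (-a) Γp Γm where
  injective := S.injective
  isClosed := by
    have h : ((LinearMap.range (j.prod (-a)) : Submodule 𝕜 (V × V)) : Set (V × V)) =
        (fun p : V × V => (p.1, -p.2)) ⁻¹'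
          ((LinearMap.range (j.prod a) : Submodule 𝕜 (V × V)) : Set (V × V)) := by
      ext ⟨x, y⟩
      simp [Prod.ext_iff, neg_eq_iff_eq_neg]
    rw [h]
    exact S.isClosed.preimage (by fun_prop)
  green u v := by
    have := S.green u v
    simp only [LinearMap.neg_apply, inner_neg_left, inner_neg_right]
    linear_combination -this
  surjective h k := by
    obtain ⟨w, h1, h2⟩ := S.surjective k h
    exact ⟨w, h2, h1⟩
  exists_neg y hy := by
    obtain ⟨x, h1, h2⟩ := S.exists_pos y fun u hm hp => by simpa using hy u hp hm
    exact ⟨x, h1, by simp [h2]⟩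
  exists_pos y hy := by
    obtain ⟨x, h1, h2⟩ := S.exists_neg y fun u hm hp => by
      simpa [sub_eq_add_neg] using hy u hp hm
    exact ⟨x, h1, by simp [h2]⟩

theorem two_mul_re_inner (S : BoundarySystem j a Γm Γp) (u : D) :
    2 * RCLike.re (inner 𝕜 (a u) (j u)) = ‖Γp u‖ ^ 2 - ‖Γm u‖ ^ 2 := by
  have h := congrArg RCLike.re (S.green u u)
  rw [map_add, map_sub, inner_self_eq_norm_sq, inner_self_eq_norm_sq,
    inner_re_symm (j u) (a u)] at h
  linarith

/-- The boundary map `Γp` is continuous for the graph norm, by the closed graph theorem. -/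
theorem exists_norm_le (S : BoundarySystem j a Γm Γp) :
    ∃ C : ℝ, ∀ u, ‖Γp u‖ ≤ C * (‖j u‖ + ‖a u‖) := by
  have hinj : Function.Injective (j.prod a) := fun u v h => S.injective (congrArg Prod.fst h)
  let e := LinearEquiv.ofInjective (j.prod a) hinj
  have : CompleteSpace (LinearMap.range (j.prod a)) := S.isClosed.completeSpace_coe
  let g : LinearMap.range (j.prod a) →ₗ[𝕜] UniformSpace.Completion Hp :=
    (UniformSpace.Completion.toComplₗᵢ (𝕜 := 𝕜) (E := Hp)).toLinearMap ∘ₗ Γp ∘ₗ e.symm.toLinearMap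
  have hj : ∀ p, j (e.symm p) = (p : V × V).1 := fun p =>
    congrArg (fun q : LinearMap.range (j.prod a) => (q : V × V).1) (e.apply_symm_apply p)
  have ha : ∀ p, a (e.symm p) = (p : V × V).2 := fun p =>
    congrArg (fun q : LinearMap.range (j.prod a) => (q : V × V).2) (e.apply_symm_apply p)
  have hg : Continuous g := by
    refine g.continuous_of_seq_closed_graph fun u x y hu hgu => ?_
    have hdense : Dense (Set.range ((↑) : Hp → UniformSpace.Completion Hp)) :=
      UniformSpace.Completion.denseRange_coe
    rw [← sub_eq_zero]
    refine hdense.eq_zero_of_inner_left (𝕜 := 𝕜) ?_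
    rintro _ ⟨k, rfl⟩
    obtain ⟨v, hvm, hvp⟩ := S.surjective 0 k
    have hinner : ∀ p, inner 𝕜 (g p) (k : UniformSpace.Completion Hp) =
        inner 𝕜 (p : V × V).2 (j v) + inner 𝕜 (p : V × V).1 (a v) := fun p => by
      have := S.green (e.symm p) v
      rw [hvm, hvp, inner_zero_right, sub_zero, hj, ha] at this
      rw [this]
      exact UniformSpace.Completion.inner_coe _ _
    have h1 : Tendsto (fun n => inner 𝕜 (g (u n)) (k : UniformSpace.Completion Hp)) atTop
        (𝓝 (inner 𝕜 y (k : UniformSpace.Completion Hp))) :=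
      hgu.inner tendsto_const_nhds
    have h2 : Tendsto (fun n => inner 𝕜 (g (u n)) (k : UniformSpace.Completion Hp)) atTop
        (𝓝 (inner 𝕜 (g x) (k : UniformSpace.Completion Hp))) := by
      simp only [hinner]
      have hu' : Tendsto (fun n => (u n : V × V)) atTop (𝓝 (x : V × V)) :=
        (continuous_subtype_val.tendsto x).comp hu
      exact (((continuous_snd.tendsto _).comp hu').inner tendsto_const_nhds).add
        (((continuous_fst.tendsto _).comp hu').inner tendsto_const_nhds)
    rw [inner_sub_left, tendsto_nhds_unique h1 h2, sub_self]
  let G : LinearMap.range (j.prod a) →L[𝕜] UniformSpace.Completion Hp := ⟨g, hg⟩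
  refine ⟨‖G‖, fun u => ?_⟩
  have h1 : ‖G (e u)‖ = ‖Γp u‖ := by
    change ‖((Γp (e.symm (e u)) : Hp) : UniformSpace.Completion Hp)‖ = _
    rw [e.symm_apply_apply, UniformSpace.Completion.norm_coe]
  have h2 : ‖e u‖ ≤ ‖j u‖ + ‖a u‖ := by
    change max ‖j u‖ ‖a u‖ ≤ _
    exact max_le (by linarith [norm_nonneg (a u)]) (by linarith [norm_nonneg (j u)])
  rw [← h1]
  exact (G.le_opNorm _).trans (by gcongr)

theorem norm_le_norm_sub (S : BoundarySystem j a Γm Γp) {u : D} (hu : ‖Γp u‖ ≤ ‖Γm u‖) :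
    ‖j u‖ ≤ ‖j u - a u‖ := by
  have h1 := S.two_mul_re_inner u
  have h2 : ‖Γp u‖ ^ 2 ≤ ‖Γm u‖ ^ 2 := by gcongr
  have h3 := re_inner_le_norm (𝕜 := 𝕜) (j u - a u) (j u)
  rw [inner_sub_left, map_sub, inner_self_eq_norm_sq] at h3
  by_contra! h
  nlinarith [norm_nonneg (j u), norm_nonneg (j u - a u)]

/-- If `j` and `a` converge along a sequence, then the limits come from an element of `D`, and
`Γp` converges along with them. -/
theorem exists_tendsto (S : BoundarySystem j a Γm Γp) {u : ℕ → D} {p q : V}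
    (hp : Tendsto (fun n => j (u n)) atTop (𝓝 p)) (hq : Tendsto (fun n => a (u n)) atTop (𝓝 q)) :
    ∃ x, j x = p ∧ a x = q ∧ Tendsto (fun n => Γm (u n)) atTop (𝓝 (Γm x)) ∧
      Tendsto (fun n => Γp (u n)) atTop (𝓝 (Γp x)) := by
  obtain ⟨x, hx⟩ : (p, q) ∈ LinearMap.range (j.prod a) :=
    S.isClosed.mem_of_tendsto (hp.prodMk_nhds hq) (Eventually.of_forall fun n => ⟨u n, rfl⟩)
  have hjx : j x = p := congrArg Prod.fst hx
  have hax : a x = q := congrArg Prod.snd hx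
  have hlim : Tendsto (fun n => ‖j (u n - x)‖ + ‖a (u n - x)‖) atTop (𝓝 0) := by
    simp only [map_sub, hjx, hax]
    simpa using (tendsto_iff_norm_sub_tendsto_zero.1 hp).add
      (tendsto_iff_norm_sub_tendsto_zero.1 hq)
  obtain ⟨C, hC⟩ := S.exists_norm_le
  obtain ⟨C', hC'⟩ := S.symm.exists_norm_le
  refine ⟨x, hjx, hax, ?_, ?_⟩ <;> rw [tendsto_iff_norm_sub_tendsto_zero]
  · refine squeeze_zero (fun _ => norm_nonneg _) (fun n => ?_) (by simpa only [map_sub, mul_zero] using hlim.const_mul C')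
    have h := hC' (u n - x)
    rwa [LinearMap.neg_apply, norm_neg, map_sub, map_sub, map_sub] at h
  · refine squeeze_zero (fun _ => norm_nonneg _) (fun n => ?_) (by simpa only [map_sub, mul_zero] using hlim.const_mul C)
    simpa only [map_sub] using hC (u n - x)

/-- The restriction of `a` to `{u | Φ (Γm u) = Γp u}` satisfies the range condition when `Φ` is
a contraction. -/
theorem exists_sub_eq (S : BoundarySystem j a Γm Γp) (Φ : Hm →ₗ[𝕜] Hp) (hΦ : ∀ x, ‖Φ x‖ ≤ ‖x‖)
    (y : V) : ∃ u, Φ (Γm u) = Γp u ∧ j u - a u = y := by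
  let K : Submodule 𝕜 D := LinearMap.ker (Φ ∘ₗ Γm - Γp)
  have hK : ∀ u, u ∈ K ↔ Φ (Γm u) = Γp u := fun u => by simp [K, sub_eq_zero]
  have hKle : ∀ u ∈ K, ‖Γp u‖ ≤ ‖Γm u‖ := fun u hu => by
    rw [← (hK u).1 hu]
    exact hΦ _
  let R : Submodule 𝕜 V := K.map (j - a)
  have hclosed : IsClosed (R : Set V) := by
    refine IsSeqClosed.isClosed fun f p hf hfp => ?_
    choose u huK hu using hf
    have hcauchy : CauchySeq (fun n => j (u n)) := by
      refine Metric.cauchySeq_iff'.2 fun ε hε => ?_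
      obtain ⟨N, hN⟩ := Metric.cauchySeq_iff'.1 hfp.cauchySeq ε hε
      refine ⟨N, fun n hn => lt_of_le_of_lt ?_ (hN n hn)⟩
      have h := S.norm_le_norm_sub (hKle _ (K.sub_mem (huK n) (huK N)))
      rw [dist_eq_norm, dist_eq_norm, ← hu, ← hu, ← map_sub, ← map_sub]
      exact h
    obtain ⟨q, hq⟩ := cauchySeq_tendsto_of_complete hcauchy
    have ha : Tendsto (fun n => a (u n)) atTop (𝓝 (q - p)) := by
      refine (hq.sub hfp).congr fun n => ?_
      rw [← hu]
      simp
    obtain ⟨x, hjx, hax, hm, hp⟩ := S.exists_tendsto hq ha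
    have hΦm : Tendsto (fun n => Φ (Γm (u n))) atTop (𝓝 (Φ (Γm x))) :=
      ((Φ.mkContinuous 1 fun z => by simpa using hΦ z).continuous.tendsto _).comp hm
    refine ⟨x, (hK x).2 (tendsto_nhds_unique hΦm (hp.congr fun n => ((hK _).1 (huK n)).symm)), ?_⟩
    simp [hjx, hax]
  have hbot : Rᗮ = ⊥ := by
    rw [Submodule.eq_bot_iff]
    intro y hy
    have hy' : ∀ u ∈ K, inner 𝕜 y (j u - a u) = 0 := fun u hu =>
      (Submodule.mem_orthogonal' R y).1 hy _ ⟨u, hu, rfl⟩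
    obtain ⟨x, hjx, hax⟩ := S.exists_neg y fun u hm hp =>
      hy' u ((hK u).2 (by rw [hm, hp, map_zero]))
    obtain ⟨v, hvm, hvp⟩ := S.surjective (Γm x) (Φ (Γm x))
    have h1 := hy' v ((hK v).2 (by rw [hvm, hvp]))
    have h2 := S.green x v
    rw [hjx, hax, hvm, hvp, inner_neg_left] at h2
    rw [inner_sub_right] at h1
    have h3 : inner 𝕜 (Γm x) (Γm x) = inner 𝕜 (Γp x) (Φ (Γm x)) := by
      linear_combination h1 + h2
    have h4 : ‖Γm x‖ ^ 2 ≤ ‖Γp x‖ * ‖Γm x‖ := by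
      rw [← inner_self_eq_norm_sq (𝕜 := 𝕜), h3]
      exact (re_inner_le_norm _ _).trans (by gcongr; exact hΦ _)
    have h5 := S.two_mul_re_inner x
    rw [hjx, hax, inner_neg_left, map_neg, inner_self_eq_norm_sq] at h5
    have h6 : ‖Γm x‖ ≤ ‖Γp x‖ := by
      by_contra! h
      nlinarith [norm_nonneg (Γp x), norm_nonneg (Γm x)]
    have h7 : ‖Γm x‖ ^ 2 ≤ ‖Γp x‖ ^ 2 := by gcongr
    have h8 : ‖y‖ ^ 2 = 0 := le_antisymm (by linarith) (sq_nonneg _)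
    simpa using h8
  have : CompleteSpace R := hclosed.completeSpace_coe
  have htop : R = ⊤ := Submodule.orthogonal_eq_bot_iff.1 hbot
  obtain ⟨u, hu, huy⟩ : y ∈ R := htop ▸ Submodule.mem_top
  exact ⟨u, (hK u).1 hu, huy⟩

/-- The boundary space `Hp` is automatically complete: it is isomorphic to `ker (1 - A)`. -/
theorem completeSpace (S : BoundarySystem j a Γm Γp) : CompleteSpace Hp := by
  have hex : ∀ k, ∃ z, Γp z = k ∧ a z = j z := fun k => by
    obtain ⟨w, -, hw⟩ := S.surjective 0 k
    obtain ⟨u, hu, hu'⟩ := S.exists_sub_eq 0 (by simp) (j w - a w)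
    refine ⟨w - u, by simp [hw, ← hu], ?_⟩
    rw [map_sub, map_sub]
    refine sub_eq_zero.1 (Eq.trans ?_ (sub_eq_zero.2 hu'))
    abel
  have hle : ∀ z, a z = j z → ‖j z‖ ≤ ‖Γp z‖ := fun z hz => by
    have h := S.two_mul_re_inner z
    rw [hz, inner_self_eq_norm_sq] at h
    exact abs_le_of_sq_le_sq' (by nlinarith [sq_nonneg ‖Γm z‖, sq_nonneg ‖j z‖])
      (norm_nonneg _) |>.2
  refine Metric.complete_of_cauchySeq_tendsto fun k hk => ?_
  choose z hz hz' using fun n => hex (k n)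
  have hcauchy : CauchySeq (fun n => j (z n)) := by
    refine Metric.cauchySeq_iff'.2 fun ε hε => ?_
    obtain ⟨N, hN⟩ := Metric.cauchySeq_iff'.1 hk ε hε
    refine ⟨N, fun n hn => lt_of_le_of_lt ?_ (hN n hn)⟩
    rw [dist_eq_norm, dist_eq_norm, ← hz, ← hz, ← map_sub, ← map_sub]
    exact hle _ (by simp [hz'])
  obtain ⟨q, hq⟩ := cauchySeq_tendsto_of_complete hcauchy
  obtain ⟨x, -, -, -, hp⟩ := S.exists_tendsto hq (hq.congr fun n => (hz' n).symm)
  exact ⟨Γp x, hp.congr hz⟩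

section Maximal

variable {K : Submodule 𝕜 D}

/-- A subspace on which the restriction of `a` is m-dissipative is maximal. -/
theorem mem_of_forall_norm_le (S : BoundarySystem j a Γm Γp)
    (hrange : ∀ y, ∃ u ∈ K, j u - a u = y) {w : D}
    (hw : ∀ u ∈ K, ‖Γp (u + w)‖ ≤ ‖Γm (u + w)‖) : w ∈ K := by
  obtain ⟨u, hu, huw⟩ := hrange (j w - a w)
  have h := S.norm_le_norm_sub (hw (-u) (K.neg_mem hu))
  have h0 : j (-u + w) - a (-u + w) = 0 := by
    rw [map_add, map_add, map_neg, map_neg]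
    refine Eq.trans ?_ (sub_eq_zero.2 huw.symm)
    abel
  rw [h0, norm_zero, norm_le_zero_iff] at h
  have : -u + w = 0 := S.injective (by rw [h, map_zero])
  rwa [← neg_add_eq_zero.1 this]

theorem exists_mem_eq (S : BoundarySystem j a Γm Γp) (hdiss : ∀ u ∈ K, ‖Γp u‖ ≤ ‖Γm u‖)
    (hrange : ∀ y, ∃ u ∈ K, j u - a u = y) (h : Hm) : ∃ u ∈ K, Γm u = h := by
  have : CompleteSpace Hp := S.completeSpace
  have : CompleteSpace Hm := S.symm.completeSpace
  have hbot : (K.map Γm)ᗮ = ⊥ := by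
    rw [Submodule.eq_bot_iff]
    intro h hh
    obtain ⟨w, hwm, hwp⟩ := S.surjective h 0
    have horth : ∀ u ∈ K, inner 𝕜 (Γm u) h = 0 := fun u hu => hh _ ⟨u, hu, rfl⟩
    have hwK : w ∈ K := S.mem_of_forall_norm_le hrange fun u hu => by
      rw [map_add, map_add, hwm, hwp, add_zero]
      refine (hdiss u hu).trans ?_
      have := norm_add_sq_eq_norm_sq_add_norm_sq_of_inner_eq_zero _ _ (horth u hu)
      exact abs_le_of_sq_le_sq' (by nlinarith [norm_nonneg h]) (norm_nonneg _) |>.2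
    have := horth w hwK
    rwa [hwm, inner_self_eq_zero] at this
  have hmem : h ∈ closure ((K.map Γm : Submodule 𝕜 Hm) : Set Hm) := by
    rw [← Submodule.topologicalClosure_coe, Submodule.topologicalClosure_eq_top_iff.2 hbot]
    trivial
  obtain ⟨f, hf, hfh⟩ := mem_closure_iff_seq_limit.1 hmem
  choose u huK hu using hf
  have hcauchy : CauchySeq (fun n => Γp (u n)) := by
    refine Metric.cauchySeq_iff'.2 fun ε hε => ?_
    obtain ⟨N, hN⟩ := Metric.cauchySeq_iff'.1 hfh.cauchySeq ε hε
    refine ⟨N, fun n hn => lt_of_le_of_lt ?_ (hN n hn)⟩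
    rw [dist_eq_norm, dist_eq_norm, ← hu, ← hu, ← map_sub, ← map_sub]
    exact hdiss _ (K.sub_mem (huK n) (huK N))
  obtain ⟨k, hk⟩ := cauchySeq_tendsto_of_complete hcauchy
  obtain ⟨w, hwm, hwp⟩ := S.surjective h k
  refine ⟨w, S.mem_of_forall_norm_le hrange fun v hv => ?_, hwm⟩
  rw [map_add, map_add, hwm, hwp]
  refine le_of_tendsto_of_tendsto' (tendsto_const_nhds.add hk).norm
    (tendsto_const_nhds.add hfh).norm fun n => ?_
  rw [← hu, ← map_add, ← map_add]
  exact hdiss _ (K.add_mem hv (huK n))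

theorem exists_contraction (S : BoundarySystem j a Γm Γp) (hdiss : ∀ u ∈ K, ‖Γp u‖ ≤ ‖Γm u‖)
    (hrange : ∀ y, ∃ u ∈ K, j u - a u = y) :
    ∃ Φ : Hm →ₗ[𝕜] Hp, (∀ x, ‖Φ x‖ ≤ ‖x‖) ∧ ∀ u, u ∈ K ↔ Φ (Γm u) = Γp u := by
  have huniq : ∀ u ∈ K, ∀ v ∈ K, Γm u = Γm v → Γp u = Γp v := fun u hu v hv huv => by
    have := hdiss _ (K.sub_mem hu hv)
    rwa [map_sub, map_sub, huv, sub_self, norm_zero, norm_le_zero_iff, sub_eq_zero] at this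
  choose s hsK hs using S.exists_mem_eq hdiss hrange
  let Φ : Hm →ₗ[𝕜] Hp :=
    { toFun := fun h => Γp (s h)
      map_add' := fun x y => by
        rw [← map_add]
        exact huniq _ (hsK _) _ (K.add_mem (hsK _) (hsK _)) (by simp [hs])
      map_smul' := fun c x => by
        rw [RingHom.id_apply, ← map_smul]
        exact huniq _ (hsK _) _ (K.smul_mem _ (hsK _)) (by simp [hs]) }
  have hΦ : ∀ x, ‖Φ x‖ ≤ ‖x‖ := fun x => by
    have h := hdiss _ (hsK x)
    rwa [hs] at h
  have hΦK : ∀ u ∈ K, Φ (Γm u) = Γp u := fun u hu => huniq _ (hsK _) _ hu (hs _)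
  refine ⟨Φ, hΦ, fun u => ⟨hΦK u, fun hu => S.mem_of_forall_norm_le hrange fun v hv => ?_⟩⟩
  rw [map_add Γp, ← hΦK v hv, ← hu, ← map_add, ← map_add]
  exact hΦ _

end Maximal

end BoundarySystem

theorem IsBoundaryQuadruple.exists_eq {A : V →ₗ.[𝕜] V} {Hm Hp : Type*}
    [NormedAddCommGroup Hm] [InnerProductSpace 𝕜 Hm]
    [NormedAddCommGroup Hp] [InnerProductSpace 𝕜 Hp]
    {Γm : A.domain →ₗ[𝕜] Hm} {Γp : A.domain →ₗ[𝕜] Hp} (hq : IsBoundaryQuadruple A Γm Γp)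
    (h : Hm) (k : Hp) : ∃ w, Γm w = h ∧ Γp w = k := by
  obtain ⟨hm, hp, -, hsup⟩ := hq
  have hdecomp : ∀ w, ∃ x y, Γm x = 0 ∧ Γp y = 0 ∧ x + y = w := fun w => by
    obtain ⟨x, hx, y, hy, hxy⟩ := Submodule.mem_sup.1 (hsup ▸ Submodule.mem_top (x := w))
    exact ⟨x, y, hx, hy, hxy⟩
  obtain ⟨v, rfl⟩ := hm h
  obtain ⟨w, rfl⟩ := hp k
  obtain ⟨x, y, hx, hy, rfl⟩ := hdecomp v
  obtain ⟨x', y', hx', hy', rfl⟩ := hdecomp w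
  exact ⟨x' + y, by simp [hx, hx'], by simp [hy, hy']⟩

/-- The adjoint of `-A₀`, characterized by its graph. -/
theorem LinearPMap.exists_mem_adjoint_neg {A₀ : V →ₗ.[𝕜] V} (hdense : Dense (A₀.domain : Set V))
    {x y : V} (h : ∀ u : A₀.domain, inner 𝕜 y (u : V) + inner 𝕜 x (A₀ u) = 0) :
    ∃ hx : x ∈ ((-A₀).adjoint).domain, (-A₀).adjoint ⟨x, hx⟩ = y := by
  have h' : ∀ u : (-A₀).domain, inner 𝕜 y (u : V) = inner 𝕜 x ((-A₀) u) := fun u => by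
    rw [LinearPMap.neg_apply, inner_neg_right]
    exact eq_neg_of_add_eq_zero_left (h u)
  exact ⟨LinearPMap.mem_adjoint_domain_of_exists _ ⟨y, h'⟩,
    LinearPMap.adjoint_apply_eq (T := -A₀) hdense _ h'⟩

theorem LinearPMap.inner_adjoint_neg_add {A₀ : V →ₗ.[𝕜] V}
    (hdense : Dense (A₀.domain : Set V)) (x : ((-A₀).adjoint).domain) (u : A₀.domain) :
    inner 𝕜 ((-A₀).adjoint x) (u : V) + inner 𝕜 (x : V) (A₀ u) = 0 := by
  have h := LinearPMap.adjoint_isFormalAdjoint (T := -A₀) hdense x u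
  rw [LinearPMap.neg_apply, inner_neg_right] at h
  rw [h, neg_add_cancel]

theorem IsBoundaryQuadruple.boundarySystem {Hm Hp : Type*}
    [NormedAddCommGroup Hm] [InnerProductSpace 𝕜 Hm]
    [NormedAddCommGroup Hp] [InnerProductSpace 𝕜 Hp]
    {A₀ : V →ₗ.[𝕜] V} (hdense : Dense (A₀.domain : Set V)) (hskew : SkewSymmetric A₀)
    {Γm : ((-A₀).adjoint).domain →ₗ[𝕜] Hm} {Γp : ((-A₀).adjoint).domain →ₗ[𝕜] Hp}
    (hq : IsBoundaryQuadruple (-A₀).adjoint Γm Γp) :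
    BoundarySystem ((-A₀).adjoint).domain.subtype ((-A₀).adjoint).toFun Γm Γp := by
  have hker : ∀ u : A₀.domain, ∃ hu : (u : V) ∈ ((-A₀).adjoint).domain,
      (-A₀).adjoint ⟨u, hu⟩ = A₀ u ∧ Γm ⟨u, hu⟩ = 0 ∧ Γp ⟨u, hu⟩ = 0 := fun u => by
    obtain ⟨hu, hAu⟩ := LinearPMap.exists_mem_adjoint_neg hdense (hskew u)
    have hzero : ∀ v, inner 𝕜 (Γp v) (Γp ⟨u, hu⟩) - inner 𝕜 (Γm v) (Γm ⟨u, hu⟩) = 0 := fun v => by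
      rw [← hq.2.2.1, hAu]
      exact LinearPMap.inner_adjoint_neg_add hdense v u
    obtain ⟨v, hvm, hvp⟩ := hq.exists_eq (Γm ⟨u, hu⟩) 0
    obtain ⟨w, hwm, hwp⟩ := hq.exists_eq 0 (Γp ⟨u, hu⟩)
    have h1 := hzero v
    have h2 := hzero w
    rw [hvm, hvp, inner_zero_left, zero_sub, neg_eq_zero, inner_self_eq_zero] at h1
    rw [hwm, hwp, inner_zero_left, sub_zero, inner_self_eq_zero] at h2
    exact ⟨hu, hAu, h1, h2⟩
  refine ⟨Subtype.val_injective, ?_, hq.2.2.1, hq.exists_eq, fun y hy => ?_, fun y hy => ?_⟩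
  · have hgraph : LinearMap.range (((-A₀).adjoint).domain.subtype.prod ((-A₀).adjoint).toFun) =
        ((-A₀).adjoint).graph := by
      ext ⟨p, q⟩
      simp [LinearPMap.mem_graph_iff, Prod.ext_iff]
    rw [hgraph]
    exact LinearPMap.adjoint_isClosed (T := -A₀) hdense
  · obtain ⟨hx, hAx⟩ := LinearPMap.exists_mem_adjoint_neg hdense (x := y) (y := -y) fun u => by
      obtain ⟨hu, hAu, hm, hp⟩ := hker u
      have h := hy ⟨u, hu⟩ hm hp
      change inner 𝕜 y ((u : V) - (-A₀).adjoint ⟨u, hu⟩) = 0 at h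
      rw [hAu, inner_sub_right] at h
      rw [inner_neg_left]
      linear_combination -h
    exact ⟨⟨y, hx⟩, rfl, hAx⟩
  · obtain ⟨hx, hAx⟩ := LinearPMap.exists_mem_adjoint_neg hdense (x := y) (y := y) fun u => by
      obtain ⟨hu, hAu, hm, hp⟩ := hker u
      have h := hy ⟨u, hu⟩ hm hp
      change inner 𝕜 y ((u : V) + (-A₀).adjoint ⟨u, hu⟩) = 0 at h
      rwa [hAu, inner_add_right] at h
    exact ⟨⟨y, hx⟩, rfl, hAx⟩

/-- A dissipative extension of a skew-symmetric operator `A₀` is a restriction of `(-A₀)*`. -/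
theorem Dissipative.le_adjoint_neg {A₀ B : V →ₗ.[𝕜] V} (hB : Dissipative B)
    (hdense : Dense (A₀.domain : Set V)) (hskew : SkewSymmetric A₀) (hA₀B : A₀ ≤ B) :
    B ≤ (-A₀).adjoint := by
  have key : ∀ (x : B.domain) (u : A₀.domain),
      inner 𝕜 (B x) (u : V) + inner 𝕜 (x : V) (A₀ u) = 0 := fun x u => by
    set c : 𝕜 := inner 𝕜 (B x) (u : V) + inner 𝕜 (x : V) (A₀ u) with hc
    let u' : B.domain := ⟨u, hA₀B.1 u.2⟩
    have hBu : B u' = A₀ u := (hA₀B.2 (x := u) (y := u') rfl).symm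
    have hre : ∀ t : ℝ, RCLike.re (inner 𝕜 (B x) (x : V)) + t * ‖c‖ ^ 2 ≤ 0 := fun t => by
      set l : 𝕜 := (t : 𝕜) * (starRingEnd 𝕜) c with hl
      have h := hB (x + l • u')
      have h0 : RCLike.re (inner 𝕜 (l • A₀ u) (l • (u : V))) = 0 := by
        have h1 := congrArg RCLike.re (hskew (l • u) (l • u))
        rw [map_add, inner_re_symm ((l • u : A₀.domain) : V), LinearPMap.map_smul, map_zero] at h1
        change RCLike.re (inner 𝕜 (l • A₀ u) (l • (u : V))) +
          RCLike.re (inner 𝕜 (l • A₀ u) (l • (u : V))) = 0 at h1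
        linarith
      have h2 : RCLike.re (inner 𝕜 (B x) (l • (u : V))) +
          RCLike.re (inner 𝕜 (l • A₀ u) (x : V)) = t * ‖c‖ ^ 2 := by
        rw [inner_re_symm (l • A₀ u), ← map_add, inner_smul_right, inner_smul_right, ← mul_add,
          ← hc, hl, mul_assoc, RCLike.conj_mul]
        norm_cast
      rw [LinearPMap.map_add, LinearPMap.map_smul, hBu] at h
      change RCLike.re (inner 𝕜 (B x + l • A₀ u) ((x : V) + l • (u : V))) ≤ 0 at h
      rw [inner_add_left, inner_add_right, inner_add_right, map_add, map_add, map_add] at h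
      linarith
    by_contra hne
    have hpos : 0 < ‖c‖ ^ 2 := by positivity
    have h := hre ((1 - RCLike.re (inner 𝕜 (B x) (x : V))) / ‖c‖ ^ 2)
    rw [div_mul_cancel₀ _ hpos.ne'] at h
    linarith
  refine ⟨fun x hx => (LinearPMap.exists_mem_adjoint_neg hdense (key ⟨x, hx⟩)).1, ?_⟩
  rintro x ⟨y, hy⟩ hxy
  obtain rfl : (x : V) = y := hxy
  exact (LinearPMap.exists_mem_adjoint_neg hdense (key x)).2.symm

/-- **Main theorem**: let `(H₋, H₊, Γ₋, Γ₊)` be a boundary quadruple for the densely defined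
skew-symmetric operator `A₀`, `A = (-A₀)*`, and let `B` be an operator with `A₀ ⊆ B`.
Then `B` is m-dissipative if and only if there is a linear contraction `Φ : H₋ → H₊` with
`B = A_Φ`, i.e. `D(B) = {w ∈ D(A) : Φ Γ₋ w = Γ₊ w}` and `Bw = Aw` on `D(B)`. -/
theorem mDissipative_iff_exists_contraction {Hm Hp : Type*}
    [NormedAddCommGroup Hm] [InnerProductSpace 𝕜 Hm]
    [NormedAddCommGroup Hp] [InnerProductSpace 𝕜 Hp]
    (A₀ : V →ₗ.[𝕜] V) (hdense : Dense (A₀.domain : Set V)) (hskew : SkewSymmetric A₀)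
    (Γm : ((-A₀).adjoint).domain →ₗ[𝕜] Hm) (Γp : ((-A₀).adjoint).domain →ₗ[𝕜] Hp)
    (hq : IsBoundaryQuadruple (-A₀).adjoint Γm Γp)
    (B : V →ₗ.[𝕜] V) (hA₀B : A₀ ≤ B) :
    MDissipative B ↔
      ∃ Φ : Hm →ₗ[𝕜] Hp, (∀ x, ‖Φ x‖ ≤ ‖x‖) ∧
        (∀ x : V, x ∈ B.domain ↔
          ∃ hx : x ∈ ((-A₀).adjoint).domain, Φ (Γm ⟨x, hx⟩) = Γp ⟨x, hx⟩) ∧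
        ∀ (x : V) (hxB : x ∈ B.domain) (hxA : x ∈ ((-A₀).adjoint).domain),
          B ⟨x, hxB⟩ = (-A₀).adjoint ⟨x, hxA⟩ := by
  have S := hq.boundarySystem hdense hskew
  constructor
  · rintro ⟨hdiss, hrange⟩
    obtain ⟨hdom, hval⟩ := hdiss.le_adjoint_neg hdense hskew hA₀B
    have hBA : ∀ (x : V) (hxB : x ∈ B.domain) (hxA : x ∈ ((-A₀).adjoint).domain),
        B ⟨x, hxB⟩ = (-A₀).adjoint ⟨x, hxA⟩ := fun x hxB hxA => hval rfl
    obtain ⟨Φ, hΦ, hmem⟩ := S.exists_contraction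
      (K := B.domain.comap ((-A₀).adjoint).domain.subtype)
      (fun u hu => by
        have h := S.two_mul_re_inner u
        have h' := hdiss ⟨u, hu⟩
        rw [hBA u hu u.2] at h'
        change 2 * RCLike.re (inner 𝕜 ((-A₀).adjoint u) (u : V)) = _ at h
        refine abs_le_of_sq_le_sq' ?_ (norm_nonneg _) |>.2
        linarith)
      (fun y => by
        obtain ⟨x, hx⟩ := hrange y
        refine ⟨⟨x, hdom x.2⟩, x.2, ?_⟩
        rw [← hx]
        exact congrArg _ (hBA x x.2 (hdom x.2)).symm)
    exact ⟨Φ, hΦ, fun x => ⟨fun hx => ⟨hdom hx, (hmem ⟨x, hdom hx⟩).1 hx⟩,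
      fun ⟨hx, h⟩ => (hmem ⟨x, hx⟩).2 h⟩, hBA⟩
  · rintro ⟨Φ, hΦ, hmem, hBA⟩
    refine ⟨fun x => ?_, fun y => ?_⟩
    · obtain ⟨hxA, hx⟩ := (hmem x).1 x.2
      have h := S.two_mul_re_inner ⟨x, hxA⟩
      have h' : ‖Γp ⟨x, hxA⟩‖ ^ 2 ≤ ‖Γm ⟨x, hxA⟩‖ ^ 2 := by
        rw [← hx]
        gcongr
        exact hΦ _
      change 2 * RCLike.re (inner 𝕜 ((-A₀).adjoint ⟨x, hxA⟩) (x : V)) = _ at h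
      rw [← hBA x x.2 hxA] at h
      linarith
    · obtain ⟨u, hu, huy⟩ := S.exists_sub_eq Φ hΦ y
      have huB : (u : V) ∈ B.domain := (hmem u).2 ⟨u.2, hu⟩
      refine ⟨⟨u, huB⟩, ?_⟩
      rw [hBA u huB u.2]
      exact huy
end

section
/- Let (H₋, H₊, Γ₋, Γ₊) be a boundary quadruple for a densely defined skew-symmetric operator A₀ on a Hilbert space V, with A = (−A₀)*, and let B be an operator on V with A₀ ⊆ B. Then both B and −B are m-dissipative if and only if there exists a unitary operator Φ: H₋ → H₊ such that B = A_Φ, i.e. D(B) = {w ∈ D(A) : Φ Γ₋ w = Γ₊ w} and Bw = Aw for all w ∈ D(B). (Equivalently, B generates a unitary C₀-group if and only if Φ is unitary.) -/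
variable {𝕜 V : Type*} [RCLike 𝕜] [NormedAddCommGroup V] [InnerProductSpace 𝕜 V]
  [CompleteSpace V]

/-- `B` is *skew-adjoint* if its graph is its own annihilator with respect to the form
`((u, u'), (w, w')) ↦ ⟪u', w⟫ + ⟪u, w'⟫`, i.e. `B = -B*`. -/
def SkewAdjoint (B : V →ₗ.[𝕜] V) : Prop :=
  ∀ w w' : V, (w, w') ∈ B.graph ↔
    ∀ u : B.domain, inner 𝕜 (B u) w + inner 𝕜 (u : V) w' = 0

section SkewAdjoint

omit [CompleteSpace V] in
theorem SkewAdjoint.skewSymmetric {B : V →ₗ.[𝕜] V} (hB : SkewAdjoint B) : SkewSymmetric B :=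
  fun u v => (hB v (B v)).1 (B.mem_graph v) u

omit [CompleteSpace V] in
theorem SkewSymmetric.re_inner_eq_zero {B : V →ₗ.[𝕜] V} (hB : SkewSymmetric B) (x : B.domain) :
    RCLike.re (inner 𝕜 (B x) (x : V)) = 0 := by
  have h := congrArg RCLike.re (hB x x)
  rw [map_add, inner_re_symm (x : V), map_zero] at h
  linarith

omit [CompleteSpace V] in
theorem SkewAdjoint.neg {B : V →ₗ.[𝕜] V} (hB : SkewAdjoint B) : SkewAdjoint (-B) := by
  intro w w'
  have h1 : (w, w') ∈ (-B).graph ↔ (w, -w') ∈ B.graph := by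
    simp only [LinearPMap.mem_graph_iff]
    constructor
    · rintro ⟨y, h, h'⟩
      exact ⟨y, h, by rw [← h', LinearPMap.neg_apply, neg_neg]⟩
    · rintro ⟨y, h, h'⟩
      exact ⟨y, h, by rw [LinearPMap.neg_apply, h', neg_neg]⟩
  rw [h1, hB]
  refine forall_congr' fun u => ?_
  rw [LinearPMap.neg_apply, inner_neg_left, inner_neg_right, ← neg_eq_zero]
  simp [add_comm]

omit [CompleteSpace V] in
theorem skewSymmetric_of_dissipative {B : V →ₗ.[𝕜] V} (h : Dissipative B)
    (h' : Dissipative (-B)) : SkewSymmetric B := by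
  have h0 : ∀ x : B.domain, RCLike.re (inner 𝕜 (B x) (x : V)) = 0 := by
    intro x
    refine le_antisymm (h x) ?_
    have := h' x
    rw [LinearPMap.neg_apply, inner_neg_left, map_neg] at this
    linarith
  have h1 : ∀ u v : B.domain,
      RCLike.re (inner 𝕜 (B u) (v : V) + inner 𝕜 (u : V) (B v)) = 0 := by
    intro u v
    have := h0 (u + v)
    rw [LinearPMap.map_add, Submodule.coe_add, inner_add_left, inner_add_right,
      inner_add_right] at this
    simp only [map_add, h0] at this ⊢
    rw [inner_re_symm (u : V)]
    linarith
  intro u v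
  set z := inner 𝕜 (B u) (v : V) + inner 𝕜 (u : V) (B v) with hz
  have h2 := h1 u ((starRingEnd 𝕜 z) • v)
  rw [LinearPMap.map_smul, Submodule.coe_smul, inner_smul_right, inner_smul_right, ← mul_add,
    ← hz, RCLike.conj_mul] at h2
  have h3 : ‖z‖ ^ 2 = 0 := by exact_mod_cast h2
  simpa using h3

omit [CompleteSpace V] in
theorem skewAdjoint_of_mDissipative {B : V →ₗ.[𝕜] V} (h : MDissipative B)
    (h' : MDissipative (-B)) : SkewAdjoint B := by
  have hs := skewSymmetric_of_dissipative h.1 h'.1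
  intro w w'
  constructor
  · intro hw u
    obtain ⟨y, rfl, rfl⟩ := (LinearPMap.mem_graph_iff _).1 hw
    exact hs u y
  · intro hw
    obtain ⟨x, hx⟩ := h.2 (w - w')
    have hd : w - x = w' - B x := by
      rw [sub_eq_sub_iff_add_eq_add] at hx ⊢
      rw [add_comm w', ← hx, add_comm]
    obtain ⟨u, hu⟩ := h'.2 (w - x)
    rw [LinearPMap.neg_apply, sub_neg_eq_add] at hu
    have h0 : inner 𝕜 (w - x : V) (w - x) = 0 := by
      nth_rewrite 1 [← hu]
      rw [inner_add_left]
      nth_rewrite 1 [hd]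
      rw [inner_sub_right, inner_sub_right]
      linear_combination hw u - hs u x
    have hwx : w = x := sub_eq_zero.1 (inner_self_eq_zero.1 h0)
    rw [hwx, sub_self] at hd
    rw [hwx, sub_eq_zero.1 hd.symm]
    exact B.mem_graph x

omit [CompleteSpace V] in
theorem SkewAdjoint.isClosed_graph {B : V →ₗ.[𝕜] V} (hB : SkewAdjoint B) :
    IsClosed (B.graph : Set (V × V)) := by
  have : (B.graph : Set (V × V)) =
      ⋂ u : B.domain, {p | inner 𝕜 (B u) p.1 + inner 𝕜 (u : V) p.2 = 0} := by
    ext ⟨w, w'⟩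
    simpa using hB w w'
  rw [this]
  exact isClosed_iInter fun u => isClosed_eq (by fun_prop) continuous_const

theorem SkewAdjoint.mDissipative {B : V →ₗ.[𝕜] V} (hB : SkewAdjoint B) : MDissipative B := by
  have hs := hB.skewSymmetric
  refine ⟨fun x => (hs.re_inner_eq_zero x).le, ?_⟩
  have : CompleteSpace B.graph := hB.isClosed_graph.completeSpace_coe
  let T : B.graph →L[𝕜] V :=
    ((ContinuousLinearMap.fst 𝕜 V V) - (ContinuousLinearMap.snd 𝕜 V V)).comp B.graph.subtypeL
  have hT : ∀ p : B.graph, ∃ x : B.domain, (p : V × V) = (↑x, B x) := by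
    rintro ⟨⟨w, w'⟩, hp⟩
    obtain ⟨y, rfl, rfl⟩ := (LinearPMap.mem_graph_iff _).1 hp
    exact ⟨y, rfl⟩
  have hbound : ∀ p : B.graph, ‖p‖ ≤ ‖T p‖ := by
    intro p
    obtain ⟨x, hx⟩ := hT p
    have hTp : T p = x - B x := by simp [T, hx]
    have hn : ‖p‖ = max ‖(x : V)‖ ‖B x‖ := by
      change ‖(p : V × V)‖ = _
      rw [hx, Prod.norm_def]
    have hsq : ‖(x : V) - B x‖ ^ 2 = ‖(x : V)‖ ^ 2 + ‖B x‖ ^ 2 := by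
      rw [norm_sub_sq (𝕜 := 𝕜), inner_re_symm, hs.re_inner_eq_zero]
      ring
    rw [hn, hTp]
    refine max_le ?_ ?_ <;> refine le_of_sq_le_sq ?_ (norm_nonneg _) <;> rw [hsq] <;>
      nlinarith [sq_nonneg ‖(x : V)‖, sq_nonneg ‖B x‖]
  have hanti : AntilipschitzWith 1 T :=
    AddMonoidHomClass.antilipschitz_of_bound T (by simpa using hbound)
  have hcl : IsClosed (T.range : Set V) := by
    rw [LinearMap.coe_range]
    exact hanti.isClosed_range T.uniformContinuous
  have : CompleteSpace T.range := hcl.completeSpace_coe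
  have htop : T.range = ⊤ := by
    rw [← Submodule.orthogonal_eq_bot_iff, Submodule.eq_bot_iff]
    intro d hd
    have hd' : (d, -d) ∈ B.graph := by
      rw [hB]
      intro u
      have := hd (u - B u) ⟨⟨_, B.mem_graph u⟩, by simp [T]⟩
      rw [inner_sub_left] at this
      rw [inner_neg_right]
      linear_combination -this
    obtain ⟨y, hy, hy'⟩ := (LinearPMap.mem_graph_iff _).1 hd'
    have := hs.re_inner_eq_zero y
    simp only at hy hy'
    rw [hy', hy, inner_neg_left, map_neg, neg_eq_zero, inner_self_eq_norm_sq] at this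
    simpa using this
  intro y
  obtain ⟨p, hp⟩ : y ∈ T.range := htop ▸ Submodule.mem_top
  obtain ⟨x, hx⟩ := hT p
  exact ⟨x, by rw [← hp]; simp [T, hx]⟩

theorem mDissipative_and_neg_iff_skewAdjoint {B : V →ₗ.[𝕜] V} :
    (MDissipative B ∧ MDissipative (-B)) ↔ SkewAdjoint B :=
  ⟨fun h => skewAdjoint_of_mDissipative h.1 h.2, fun h => ⟨h.mDissipative, h.neg.mDissipative⟩⟩

theorem mem_graph_adjoint_neg_iff {A₀ : V →ₗ.[𝕜] V} (hdense : Dense (A₀.domain : Set V))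
    (w w' : V) : (w, w') ∈ (-A₀).adjoint.graph ↔
      ∀ u : A₀.domain, inner 𝕜 (A₀ u) w + inner 𝕜 (u : V) w' = 0 := by
  have hd : Dense ((-A₀).domain : Set V) := hdense
  have key : ∀ u : A₀.domain, inner 𝕜 (A₀ u) w + inner 𝕜 (u : V) w' = 0 ↔
      inner 𝕜 w' (u : V) = inner 𝕜 w ((-A₀) u) := by
    intro u
    rw [LinearPMap.neg_apply, inner_neg_right, eq_neg_iff_add_eq_zero,
      ← inner_conj_symm (A₀ u), ← inner_conj_symm (u : V), ← map_add, map_eq_zero, add_comm]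
  rw [forall_congr' key, LinearPMap.mem_graph_iff]
  constructor
  · rintro ⟨y, rfl, rfl⟩ u
    exact LinearPMap.adjoint_isFormalAdjoint hd y u
  · intro h
    exact ⟨⟨w, LinearPMap.mem_adjoint_domain_of_exists w ⟨w', h⟩⟩, rfl,
      LinearPMap.adjoint_apply_eq hd _ h⟩

end SkewAdjoint

section Boundary

variable {Hm Hp : Type*} [NormedAddCommGroup Hm] [InnerProductSpace 𝕜 Hm]
  [NormedAddCommGroup Hp] [InnerProductSpace 𝕜 Hp]

/-- If every bounded functional on a Banach space `W` that vanishes on `ker γm ⊓ ker γp` is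
represented by the form `⟪γp ·, γp ·⟫ - ⟪γm ·, γm ·⟫`, then `Hm` is complete. -/
theorem completeSpace_of_boundary_form {W : Type*} [NormedAddCommGroup W] [NormedSpace 𝕜 W]
    [CompleteSpace W] (γm : W →ₗ[𝕜] Hm) (γp : W →ₗ[𝕜] Hp)
    (hcont : ∀ v, Continuous fun u => inner 𝕜 (γp v) (γp u) - inner 𝕜 (γm v) (γm u))
    (hsurj : ∀ h : Hm, ∃ u, γm u = h ∧ γp u = 0)
    (hrepr : ∀ l : W →L[𝕜] 𝕜, (∀ u, γm u = 0 → γp u = 0 → l u = 0) →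
      ∃ b, ∀ u, l u = inner 𝕜 (γp b) (γp u) - inner 𝕜 (γm b) (γm u)) :
    CompleteSpace Hm := by
  have hext : ∀ y z : UniformSpace.Completion Hm,
      (∀ h : Hm, inner 𝕜 y (h : UniformSpace.Completion Hm) = inner 𝕜 z (h : _)) → y = z := by
    intro y z h
    refine ext_inner_right 𝕜 fun k => ?_
    refine UniformSpace.Completion.induction_on k (isClosed_eq (by fun_prop) (by fun_prop)) h
  let ι : Hm →ₗ[𝕜] UniformSpace.Completion Hm :=
    (UniformSpace.Completion.toComplL (𝕜 := 𝕜) (E := Hm) : Hm →ₗ[𝕜] _)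
  let g : W →ₗ[𝕜] UniformSpace.Completion Hm := ι.comp γm
  have hg : ∀ u, g u = (γm u : UniformSpace.Completion Hm) := fun u => rfl
  have hgc : Continuous g := by
    refine LinearMap.continuous_of_seq_closed_graph (g := g) fun u x y hu hy => hext _ _ fun h => ?_
    obtain ⟨v, rfl, hv⟩ := hsurj h
    have h1 := ((hcont v).tendsto x).comp hu
    have h2 : Filter.Tendsto (fun n => inner 𝕜 (γm v : UniformSpace.Completion Hm) (g (u n)))
        Filter.atTop (nhds (inner 𝕜 (γm v : UniformSpace.Completion Hm) y)) :=
      tendsto_const_nhds.inner hy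
    have h3 := tendsto_nhds_unique h2 (by simpa [Function.comp_def, hv, hg] using h1.neg)
    rw [← inner_conj_symm, h3, ← inner_conj_symm (g x), hg]
    simp
  have hs : Function.Surjective ((↑) : Hm → UniformSpace.Completion Hm) := by
    intro y
    obtain ⟨b, hb⟩ := hrepr ((innerSL 𝕜 y).comp ⟨g, hgc⟩) (fun u hu _ => by
      simp [hg, hu, UniformSpace.Completion.coe_zero])
    refine ⟨-γm b, (hext _ _ fun h => ?_).symm⟩
    obtain ⟨v, rfl, hv⟩ := hsurj h
    have := hb v
    simpa [hg, hv] using this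
  have hi := (UniformSpace.Completion.isUniformInducing_coe Hm)
  rw [completeSpace_iff_isComplete_range hi, hs.range_eq]
  exact isComplete_univ

theorem norm_snd_eq_norm_fst_of_lagrangian (G : Submodule 𝕜 (Hm × Hp))
    (hG : ∀ p, p ∈ G ↔ ∀ q ∈ G, inner 𝕜 q.2 p.2 = inner 𝕜 q.1 p.1) (p : Hm × Hp) (hp : p ∈ G) :
    ‖p.2‖ = ‖p.1‖ := by
  rw [norm_eq_sqrt_re_inner (𝕜 := 𝕜), norm_eq_sqrt_re_inner (𝕜 := 𝕜), (hG p).1 hp p hp]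

/-- A Lagrangian subspace of `Hm × Hp` projects onto `Hm`. -/
theorem exists_mem_of_lagrangian [CompleteSpace Hm] [CompleteSpace Hp]
    (G : Submodule 𝕜 (Hm × Hp))
    (hG : ∀ p, p ∈ G ↔ ∀ q ∈ G, inner 𝕜 q.2 p.2 = inner 𝕜 q.1 p.1) (h : Hm) :
    ∃ k : Hp, (h, k) ∈ G := by
  have hcl : IsClosed (G : Set (Hm × Hp)) := by
    have : (G : Set (Hm × Hp)) =
        ⋂ q ∈ G, {p | inner 𝕜 q.2 p.2 = inner 𝕜 q.1 p.1} := by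
      ext p
      simpa using hG p
    rw [this]
    exact isClosed_biInter fun q _ => isClosed_eq (by fun_prop) (by fun_prop)
  have : CompleteSpace G := hcl.completeSpace_coe
  have hnorm := norm_snd_eq_norm_fst_of_lagrangian G hG
  let T : G →L[𝕜] Hm := (ContinuousLinearMap.fst 𝕜 Hm Hp).comp G.subtypeL
  have hanti : AntilipschitzWith 1 T := by
    refine AddMonoidHomClass.antilipschitz_of_bound T fun p => ?_
    have : ‖p‖ = max ‖(p : Hm × Hp).1‖ ‖(p : Hm × Hp).2‖ := rfl
    rw [this, hnorm p p.2, max_self]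
    simp [T]
  have hclr : IsClosed (T.range : Set Hm) := by
    rw [LinearMap.coe_range]
    exact hanti.isClosed_range T.uniformContinuous
  have : CompleteSpace T.range := hclr.completeSpace_coe
  have htop : T.range = ⊤ := by
    rw [← Submodule.orthogonal_eq_bot_iff, Submodule.eq_bot_iff]
    intro d hd
    have hd' : (d, (0 : Hp)) ∈ G := by
      rw [hG]
      intro q hq
      rw [hd q.1 ⟨⟨q, hq⟩, rfl⟩, inner_zero_right]
    simpa using (hnorm _ hd').symm
  obtain ⟨p, hp⟩ : h ∈ T.range := htop ▸ Submodule.mem_top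
  exact ⟨(p : Hm × Hp).2, by rw [← hp]; exact p.2⟩

/-- A Lagrangian subspace of `Hm × Hp` is the graph of a unitary operator. -/
theorem exists_unitary_of_lagrangian [CompleteSpace Hm] [CompleteSpace Hp]
    (G : Submodule 𝕜 (Hm × Hp))
    (hG : ∀ p, p ∈ G ↔ ∀ q ∈ G, inner 𝕜 q.2 p.2 = inner 𝕜 q.1 p.1) :
    ∃ Φ : Hm →ₗ[𝕜] Hp, (∀ x, ‖Φ x‖ = ‖x‖) ∧ Function.Surjective Φ ∧
      ∀ p, p ∈ G ↔ Φ p.1 = p.2 := by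
  have hnorm := norm_snd_eq_norm_fst_of_lagrangian G hG
  have hfst := exists_mem_of_lagrangian G hG
  have hsnd : ∀ k : Hp, ∃ h : Hm, (h, k) ∈ G := by
    refine exists_mem_of_lagrangian
      (G.comap (LinearEquiv.prodComm 𝕜 Hp Hm : Hp × Hm →ₗ[𝕜] Hm × Hp)) fun p => ?_
    simp only [Submodule.mem_comap]
    refine (hG _).trans ⟨fun H q hq => (H _ hq).symm, fun H q hq => (H q.swap ?_).symm⟩
    simpa using hq
  have huniq : ∀ h k k', (h, k) ∈ G → (h, k') ∈ G → k = k' := by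
    intro h k k' hk hk'
    have := hnorm _ (G.sub_mem hk hk')
    simpa [sub_eq_zero] using this
  choose f hf using hfst
  let Φ : Hm →ₗ[𝕜] Hp :=
    { toFun := f
      map_add' := fun x y => huniq _ _ _ (hf _) (G.add_mem (hf x) (hf y))
      map_smul' := fun c x => huniq _ _ _ (hf _) (G.smul_mem c (hf x)) }
  refine ⟨Φ, fun x => hnorm _ (hf x), fun k => ?_, fun p => ⟨fun hp => huniq _ _ _ (hf _) hp, ?_⟩⟩
  · obtain ⟨h, hh⟩ := hsnd k
    exact ⟨h, huniq _ _ _ (hf h) hh⟩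
  · intro hp
    have := hf p.1
    rwa [show f p.1 = p.2 from hp] at this

omit [CompleteSpace V] in
theorem IsBoundaryQuadruple.exists_eq_eq {A : V →ₗ.[𝕜] V} {Γm : A.domain →ₗ[𝕜] Hm}
    {Γp : A.domain →ₗ[𝕜] Hp} (hq : IsBoundaryQuadruple A Γm Γp) (h : Hm) (k : Hp) :
    ∃ w, Γm w = h ∧ Γp w = k := by
  obtain ⟨hm, hp, -, hker⟩ := hq
  have split : ∀ u : A.domain, ∃ a b, Γm a = 0 ∧ Γp b = 0 ∧ a + b = u := by
    intro u
    obtain ⟨a, ha, b, hb, hab⟩ := Submodule.mem_sup.1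
      (hker ▸ Submodule.mem_top : u ∈ LinearMap.ker Γm ⊔ LinearMap.ker Γp)
    exact ⟨a, b, ha, hb, hab⟩
  obtain ⟨u, rfl⟩ := hm h
  obtain ⟨v, rfl⟩ := hp k
  obtain ⟨a, b, ha, hb, rfl⟩ := split u
  obtain ⟨c, d, hc, hd, rfl⟩ := split v
  exact ⟨b + c, by simp [ha, hc], by simp [hb, hd]⟩

/-- The boundary spaces of a boundary quadruple are automatically complete. -/
theorem IsBoundaryQuadruple.completeSpace {A₀ A : V →ₗ.[𝕜] V}
    (hA : ∀ w w', (w, w') ∈ A.graph ↔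
      ∀ u : A₀.domain, inner 𝕜 (A₀ u) w + inner 𝕜 (u : V) w' = 0)
    (hA₀ : A₀ ≤ A) {Γm : A.domain →ₗ[𝕜] Hm}
    {Γp : A.domain →ₗ[𝕜] Hp} (hq : IsBoundaryQuadruple A Γm Γp) :
    CompleteSpace Hm ∧ CompleteSpace Hp := by
  have hcl : IsClosed (A.graph : Set (V × V)) := by
    have : (A.graph : Set (V × V)) =
        ⋂ u : A₀.domain, {p | inner 𝕜 (A₀ u) p.1 + inner 𝕜 (u : V) p.2 = 0} := by
      ext ⟨w, w'⟩
      simpa using hA w w'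
    rw [this]
    exact isClosed_iInter fun u => isClosed_eq (by fun_prop) continuous_const
  have : CompleteSpace A.graph := hcl.completeSpace_coe
  let e : A.graph →ₗ[𝕜] A.domain :=
    ((LinearMap.fst 𝕜 V V).comp A.graph.subtype).codRestrict A.domain
      fun p => LinearPMap.mem_domain_of_mem_graph p.2
  have he : ∀ p : A.graph, A (e p) = (p : V × V).2 := by
    rintro ⟨⟨w, w'⟩, hp⟩
    obtain ⟨y, rfl, rfl⟩ := (LinearPMap.mem_graph_iff _).1 hp
    rfl
  have he1 : ∀ p : A.graph, (e p : V) = (p : V × V).1 := fun p => rfl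
  have hes : ∀ w : A.domain, ∃ p, e p = w := fun w => ⟨⟨_, A.mem_graph w⟩, rfl⟩
  have hform := hq.2.2.1
  have hcont : ∀ v, Continuous fun u : A.graph =>
      inner 𝕜 (Γp (e v)) (Γp (e u)) - inner 𝕜 (Γm (e v)) (Γm (e u)) := by
    intro v
    simp only [← hform, he, he1]
    fun_prop
  have hjoint : ∀ h k, ∃ u : A.graph, Γm (e u) = h ∧ Γp (e u) = k := by
    intro h k
    obtain ⟨w, hw⟩ := hq.exists_eq_eq h k
    obtain ⟨p, rfl⟩ := hes w
    exact ⟨p, hw⟩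
  have hzero : ∀ (x : V) (hx : x ∈ A₀.domain) (hx' : x ∈ A.domain),
      Γm ⟨x, hx'⟩ = 0 ∧ Γp ⟨x, hx'⟩ = 0 := by
    intro x hx hx'
    have h0 : ∀ v, inner 𝕜 (Γp ⟨x, hx'⟩) (Γp v) - inner 𝕜 (Γm ⟨x, hx'⟩) (Γm v) = 0 := by
      intro v
      rw [← hform, ← hA₀.2 (x := ⟨x, hx⟩) (y := ⟨x, hx'⟩) rfl]
      exact (hA v (A v)).1 (A.mem_graph v) ⟨x, hx⟩
    constructor
    · obtain ⟨w, hw, hw'⟩ := hq.exists_eq_eq (Γm ⟨x, hx'⟩) 0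
      simpa [hw, hw'] using h0 w
    · obtain ⟨w, hw, hw'⟩ := hq.exists_eq_eq 0 (Γp ⟨x, hx'⟩)
      simpa [hw, hw'] using h0 w
  have hrepr : ∀ l : A.graph →L[𝕜] 𝕜, (∀ u, Γm (e u) = 0 → Γp (e u) = 0 → l u = 0) →
      ∃ b, ∀ u, l u = inner 𝕜 (Γp (e b)) (Γp (e u)) - inner 𝕜 (Γm (e b)) (Γm (e u)) := by
    intro l hl
    obtain ⟨f, hf, -⟩ := exists_extension_norm_eq A.graph l
    let a := (InnerProductSpace.toDual 𝕜 V).symm (f.comp (ContinuousLinearMap.inl 𝕜 V V))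
    let b := (InnerProductSpace.toDual 𝕜 V).symm (f.comp (ContinuousLinearMap.inr 𝕜 V V))
    have hab : ∀ x y : V, f (x, y) = inner 𝕜 a x + inner 𝕜 b y := by
      intro x y
      simp [a, b, ← map_add]
    have hba : (b, a) ∈ A.graph := by
      rw [hA]
      intro u
      have hu' : (u : V) ∈ A.domain := hA₀.1 u.2
      have hAu : A ⟨u, hu'⟩ = A₀ u := (hA₀.2 rfl).symm
      obtain ⟨h1, h2⟩ := hzero u u.2 hu'
      have h3 := hl ⟨_, A.mem_graph ⟨u, hu'⟩⟩ h1 h2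
      rw [← hf, hab, hAu] at h3
      rw [← inner_conj_symm, ← inner_conj_symm (u : V), ← map_add, add_comm, h3, map_zero]
    refine ⟨⟨_, hba⟩, fun u => ?_⟩
    rw [← hform, he, he, he1, he1, ← hf, ← hab]
  constructor
  · exact completeSpace_of_boundary_form (Γm.comp e) (Γp.comp e) hcont
      (fun h => hjoint h 0) hrepr
  · refine completeSpace_of_boundary_form (Γp.comp e) (Γm.comp e)
      (fun v => (hcont v).neg.congr fun u => neg_sub _ _)
      (fun k => (hjoint 0 k).imp fun _ h => h.symm) ?_
    intro l hl
    obtain ⟨b, hb⟩ := hrepr l fun u h h' => hl u h' h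
    exact ⟨-b, fun u => by simp [hb u]; ring⟩

/-- A skew-adjoint operator between `A₀` and `A` is the restriction of `A` given by a unitary
operator between the boundary spaces. -/
theorem IsBoundaryQuadruple.exists_unitary {A₀ A B : V →ₗ.[𝕜] V}
    (hA : ∀ w w', (w, w') ∈ A.graph ↔
      ∀ u : A₀.domain, inner 𝕜 (A₀ u) w + inner 𝕜 (u : V) w' = 0)
    {Γm : A.domain →ₗ[𝕜] Hm} {Γp : A.domain →ₗ[𝕜] Hp} (hq : IsBoundaryQuadruple A Γm Γp)
    (hA₀ : A₀ ≤ B) (hBA : B ≤ A) (hB : SkewAdjoint B) :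
    ∃ Φ : Hm →ₗ[𝕜] Hp, (∀ x, ‖Φ x‖ = ‖x‖) ∧ Function.Surjective Φ ∧
      ∀ x : V, x ∈ B.domain ↔ ∃ hx : x ∈ A.domain, Φ (Γm ⟨x, hx⟩) = Γp ⟨x, hx⟩ := by
  obtain ⟨_, _⟩ := hq.completeSpace hA (hA₀.trans hBA)
  let G : Submodule 𝕜 (Hm × Hp) := (B.domain.comap A.domain.subtype).map (Γm.prod Γp)
  have hmem : ∀ w : A.domain, (w : V) ∈ B.domain ↔
      ∀ u : A.domain, (u : V) ∈ B.domain →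
        inner 𝕜 (Γp u) (Γp w) = inner 𝕜 (Γm u) (Γm w) := by
    intro w
    have h1 : (w : V) ∈ B.domain ↔ ((w : V), A w) ∈ B.graph := by
      refine ⟨fun h => ?_, LinearPMap.mem_domain_of_mem_graph⟩
      rw [← hBA.2 (x := ⟨w, h⟩) (y := w) rfl]
      exact B.mem_graph ⟨w, h⟩
    rw [h1, hB]
    constructor
    · intro h u hu
      rw [← sub_eq_zero, ← hq.2.2.1, ← hBA.2 (x := ⟨u, hu⟩) (y := u) rfl]
      exact h ⟨u, hu⟩
    · intro h u
      rw [hBA.2 (x := u) (y := ⟨u, hBA.1 u.2⟩) rfl]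
      exact (hq.2.2.1 ⟨u, hBA.1 u.2⟩ w).trans (sub_eq_zero.2 (h ⟨u, hBA.1 u.2⟩ u.2))
  have hGmem : ∀ w : A.domain, (Γm w, Γp w) ∈ G ↔ (w : V) ∈ B.domain := by
    intro w
    refine ⟨?_, fun h => ⟨w, h, rfl⟩⟩
    rintro ⟨u, hu, huw⟩
    obtain ⟨h1, h2⟩ := Prod.ext_iff.1 huw
    have h1 : Γm u = Γm w := h1
    have h2 : Γp u = Γp w := h2
    rw [hmem, ← h1, ← h2]
    exact (hmem u).1 hu
  obtain ⟨Φ, hΦ, hΦs, hΦG⟩ := exists_unitary_of_lagrangian G (by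
    rintro ⟨h, k⟩
    obtain ⟨w, rfl, rfl⟩ := hq.exists_eq_eq h k
    rw [hGmem, hmem]
    refine ⟨?_, fun H u hu => H (Γm u, Γp u) ⟨u, hu, rfl⟩⟩
    rintro H _ ⟨u, hu, rfl⟩
    exact H u hu)
  refine ⟨Φ, hΦ, hΦs, fun x => ⟨fun hx => ?_, ?_⟩⟩
  · exact ⟨hBA.1 hx, (hΦG (_, _)).1 ((hGmem ⟨x, hBA.1 hx⟩).2 hx)⟩
  · rintro ⟨hx, h⟩
    exact (hGmem ⟨x, hx⟩).1 ((hΦG (_, _)).2 h)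

omit [CompleteSpace V] in
/-- The restriction of `A` given by a unitary operator between the boundary spaces is
skew-adjoint. -/
theorem IsBoundaryQuadruple.skewAdjoint {A₀ A B : V →ₗ.[𝕜] V}
    (hA : ∀ w w', (w, w') ∈ A.graph ↔
      ∀ u : A₀.domain, inner 𝕜 (A₀ u) w + inner 𝕜 (u : V) w' = 0)
    {Γm : A.domain →ₗ[𝕜] Hm} {Γp : A.domain →ₗ[𝕜] Hp} (hq : IsBoundaryQuadruple A Γm Γp)
    (hA₀ : A₀ ≤ B) (hBA : B ≤ A) {Φ : Hm →ₗ[𝕜] Hp} (hΦ : ∀ x, ‖Φ x‖ = ‖x‖)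
    (hΦs : Function.Surjective Φ)
    (hdom : ∀ x : V, x ∈ B.domain ↔ ∃ hx : x ∈ A.domain, Φ (Γm ⟨x, hx⟩) = Γp ⟨x, hx⟩) :
    SkewAdjoint B := by
  have hinner : ∀ x y, inner 𝕜 (Φ x) (Φ y) = inner 𝕜 x y :=
    (⟨Φ, hΦ⟩ : Hm →ₗᵢ[𝕜] Hp).inner_map_map
  have hform : ∀ (u : B.domain) (w : A.domain), inner 𝕜 (B u) (w : V) + inner 𝕜 (u : V) (A w) =
      inner 𝕜 (Φ (Γm ⟨u, hBA.1 u.2⟩)) (Γp w - Φ (Γm w)) := by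
    intro u w
    obtain ⟨hu, hu'⟩ := (hdom u).1 u.2
    rw [hBA.2 (x := u) (y := ⟨u, hu⟩) rfl, inner_sub_right, hinner, hu']
    exact hq.2.2.1 ⟨u, hu⟩ w
  intro w w'
  constructor
  · intro hw u
    obtain ⟨y, rfl, rfl⟩ := (LinearPMap.mem_graph_iff _).1 hw
    obtain ⟨hy, hy'⟩ := (hdom y).1 y.2
    rw [hBA.2 (x := y) (y := ⟨y, hy⟩) rfl]
    exact (hform u ⟨y, hy⟩).trans (by rw [hy', sub_self, inner_zero_right])
  · intro h
    have hwA : (w, w') ∈ A.graph := by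
      rw [hA]
      intro u
      rw [hA₀.2 (x := u) (y := ⟨u, hA₀.1 u.2⟩) rfl]
      exact h ⟨u, hA₀.1 u.2⟩
    obtain ⟨y, rfl, rfl⟩ := (LinearPMap.mem_graph_iff _).1 hwA
    have h0 : Γp y - Φ (Γm y) = 0 := by
      obtain ⟨k, hk⟩ := hΦs (Γp y - Φ (Γm y))
      obtain ⟨u, rfl, hu⟩ := hq.exists_eq_eq k (Φ k)
      have hu' := h ⟨u, (hdom u).2 ⟨u.2, hu.symm⟩⟩
      rw [hform] at hu'
      rw [← inner_self_eq_zero (𝕜 := 𝕜)]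
      nth_rewrite 1 [← hk]
      exact hu'
    have hyB : (y : V) ∈ B.domain := (hdom y).2 ⟨y.2, (sub_eq_zero.1 h0).symm⟩
    rw [← hBA.2 (x := ⟨y, hyB⟩) (y := y) rfl]
    exact B.mem_graph ⟨y, hyB⟩

end Boundary

/-- Let `(H₋, H₊, Γ₋, Γ₊)` be a boundary quadruple for `A₀`, `A = (-A₀)*`, and `B ⊇ A₀`.
Then `B` and `-B` are both m-dissipative (equivalently, `B` generates a unitary `C₀`-group)
if and only if there is a unitary operator `Φ : H₋ → H₊` (a surjective linear isometry)
such that `B = A_Φ`, i.e. `D(B) = {w ∈ D(A) : Φ Γ₋ w = Γ₊ w}` and `Bw = Aw` on `D(B)`. -/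
theorem unitary_group_iff_exists_unitary {Hm Hp : Type*}
    [NormedAddCommGroup Hm] [InnerProductSpace 𝕜 Hm]
    [NormedAddCommGroup Hp] [InnerProductSpace 𝕜 Hp]
    (A₀ : V →ₗ.[𝕜] V) (hdense : Dense (A₀.domain : Set V)) (hskew : SkewSymmetric A₀)
    (Γm : ((-A₀).adjoint).domain →ₗ[𝕜] Hm) (Γp : ((-A₀).adjoint).domain →ₗ[𝕜] Hp)
    (hq : IsBoundaryQuadruple (-A₀).adjoint Γm Γp)
    (B : V →ₗ.[𝕜] V) (hA₀B : A₀ ≤ B) :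
    (MDissipative B ∧ MDissipative (-B)) ↔
      ∃ Φ : Hm →ₗ[𝕜] Hp, (∀ x, ‖Φ x‖ = ‖x‖) ∧ Function.Surjective Φ ∧
        (∀ x : V, x ∈ B.domain ↔
          ∃ hx : x ∈ ((-A₀).adjoint).domain, Φ (Γm ⟨x, hx⟩) = Γp ⟨x, hx⟩) ∧
        ∀ (x : V) (hxB : x ∈ B.domain) (hxA : x ∈ ((-A₀).adjoint).domain),
          B ⟨x, hxB⟩ = (-A₀).adjoint ⟨x, hxA⟩ := by
  have hA := mem_graph_adjoint_neg_iff hdense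
  rw [mDissipative_and_neg_iff_skewAdjoint]
  constructor
  · intro hB
    have hBA : B ≤ (-A₀).adjoint := by
      refine LinearPMap.le_of_le_graph ?_
      rintro ⟨w, w'⟩ hw
      rw [hA]
      intro u
      rw [hA₀B.2 (x := u) (y := ⟨u, hA₀B.1 u.2⟩) rfl]
      exact (hB w w').1 hw ⟨u, hA₀B.1 u.2⟩
    obtain ⟨Φ, h1, h2, h3⟩ := hq.exists_unitary hA hA₀B hBA hB
    exact ⟨Φ, h1, h2, h3, fun x _ _ => hBA.2 rfl⟩
  · rintro ⟨Φ, h1, h2, h3, h4⟩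
    have hBA : B ≤ (-A₀).adjoint := by
      refine ⟨fun x hx => ((h3 x).1 hx).1, ?_⟩
      rintro ⟨x, hx⟩ ⟨y, hy⟩ (rfl : x = y)
      exact h4 x hx hy
    exact hq.skewAdjoint hA hA₀B hBA h1 h2 h3
end
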